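/- Let X be a Tychonoff (completely regular Hausdorff) topological space. Then B_1(X) is pseudocomplete if and only if every countable subset of X is strongly Coz_δ-disjoint. -/

import Mathlib

open Set Topology Filter

/-- A real-valued function on a topological space is *Baire-one* if it is the
pointwise limit of a sequence of continuous real-valued functions. -/
def BaireOne {X : Type*} [TopologicalSpace X] (f : X → ℝ) : Prop :=
  ∃ g : ℕ → X → ℝ, (∀ n, Continuous (g n)) ∧
    ∀ x, Filter.Tendsto (fun n => g n x) Filter.atTop (nhds (f x))

/-- A *zero-set* is the preimage of `{0}` under a continuous real-valued function. -/
def IsZeroSet {X : Type*} [TopologicalSpace X] (s : Set X) : Prop :=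
  ∃ f : X → ℝ, Continuous f ∧ s = f ⁻¹' {0}

/-- A *cozero-set* is the complement of a zero-set. -/
def IsCozeroSet {X : Type*} [TopologicalSpace X] (s : Set X) : Prop :=
  IsZeroSet sᶜ

/-- A *Coz_δ-set* is a countable intersection of cozero-sets. -/
def IsCozDelta {X : Type*} [TopologicalSpace X] (s : Set X) : Prop :=
  ∃ F : ℕ → Set X, (∀ n, IsCozeroSet (F n)) ∧ s = ⋂ n, F n

/-- A *Zer_σ-set* is a countable union of zero-sets. -/
def IsZerSigma {X : Type*} [TopologicalSpace X] (s : Set X) : Prop :=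
  ∃ F : ℕ → Set X, (∀ n, IsZeroSet (F n)) ∧ s = ⋃ n, F n

/-- A family of Coz_δ-subsets is *completely Coz_δ-additive* if the union of every
subfamily is a Coz_δ-set. -/
def CompletelyCozDeltaAdditive {X : Type*} [TopologicalSpace X] {ι : Type*}
    (F : ι → Set X) : Prop :=
  (∀ i, IsCozDelta (F i)) ∧ ∀ S : Set ι, IsCozDelta (⋃ i ∈ S, F i)

/-- A set `A ⊆ X` is *strongly Coz_δ-disjoint* if there is a pairwise disjoint,
completely Coz_δ-additive family of Coz_δ-sets `F a` with `a ∈ F a` for every `a ∈ A`. -/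
def StronglyCozDeltaDisjoint {X : Type*} [TopologicalSpace X] (A : Set X) : Prop :=
  ∃ F : A → Set X, (∀ a : A, (a : X) ∈ F a) ∧
    (Pairwise fun a b : A => Disjoint (F a) (F b)) ∧
    CompletelyCozDeltaAdditive F

/-- A *π-base* of a topological space: a family of nonempty open sets such that every
nonempty open set contains a member of the family. -/
def IsPiBase {Z : Type*} [TopologicalSpace Z] (B : Set (Set Z)) : Prop :=
  (∀ U ∈ B, IsOpen U ∧ U.Nonempty) ∧
    ∀ V : Set Z, IsOpen V → V.Nonempty → ∃ U ∈ B, U ⊆ V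

/-- A space is *pseudocomplete* if it admits a sequence of π-bases `(ℬ n)` such that any
decreasing sequence `U n ∈ ℬ n` with `closure (U (n+1)) ⊆ U n` has nonempty intersection. -/
def Pseudocomplete (Z : Type*) [TopologicalSpace Z] : Prop :=
  ∃ B : ℕ → Set (Set Z), (∀ n, IsPiBase (B n)) ∧
    ∀ U : ℕ → Set Z, (∀ n, U n ∈ B n) → (∀ n, closure (U (n + 1)) ⊆ U n) →
      (⋂ n, U n).Nonempty

section Cozero

variable {X : Type*} [TopologicalSpace X]

theorem isCozeroSet_iff {s : Set X} :
    IsCozeroSet s ↔ ∃ φ : X → ℝ, Continuous φ ∧ s = {x | φ x ≠ 0} := by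
  refine exists_congr fun φ => and_congr_right fun _ => ?_
  rw [compl_eq_comm, eq_comm]
  rfl

theorem IsCozeroSet.iUnion {F : ℕ → Set X} (hF : ∀ n, IsCozeroSet (F n)) :
    IsCozeroSet (⋃ n, F n) := by
  simp only [isCozeroSet_iff] at hF ⊢
  choose φ hφ hF using hF
  have hnonneg : ∀ x n, 0 ≤ min |φ n x| 1 * (1 / 2 : ℝ) ^ n := fun x n => by positivity
  have hle : ∀ n x, min |φ n x| 1 * (1 / 2 : ℝ) ^ n ≤ (1 / 2 : ℝ) ^ n := fun n x =>
    mul_le_of_le_one_left (by positivity) (min_le_right _ _)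
  have hsum : Summable fun n : ℕ => (1 / 2 : ℝ) ^ n := summable_geometric_two
  refine ⟨fun x => ∑' n, min |φ n x| 1 * (1 / 2 : ℝ) ^ n,
    continuous_tsum (fun n => by have := hφ n; fun_prop) hsum fun n x => ?_, ?_⟩
  · rw [Real.norm_of_nonneg (hnonneg x n)]
    exact hle n x
  · ext x
    have hx : Summable fun n => min |φ n x| 1 * (1 / 2 : ℝ) ^ n :=
      Summable.of_nonneg_of_le (hnonneg x) (fun n => hle n x) hsum
    simp only [hF, mem_iUnion, mem_ofPred_eq]
    constructor
    · rintro ⟨n, hn⟩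
      have hpos : 0 < min |φ n x| 1 * (1 / 2 : ℝ) ^ n :=
        mul_pos (lt_min (abs_pos.2 hn) one_pos) (by positivity)
      exact (hx.tsum_pos (hnonneg x) n hpos).ne'
    · contrapose!
      intro h
      simp [h]

theorem IsCozDelta.iInter_iInter {F : ℕ → ℕ → Set X} (hF : ∀ m n, IsCozeroSet (F m n)) :
    IsCozDelta (⋂ m, ⋂ n, F m n) := by
  refine ⟨fun k => F k.unpair.1 k.unpair.2, fun k => hF _ _, ?_⟩
  ext x
  simp only [mem_iInter]
  refine ⟨fun h k => h _ _, fun h m n => ?_⟩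
  simpa using h (Nat.pair m n)

theorem isCozeroSet_lt {φ : X → ℝ} (hφ : Continuous φ) (r : ℝ) :
    IsCozeroSet {x | φ x < r} := by
  refine isCozeroSet_iff.2 ⟨fun x => max (r - φ x) 0, by fun_prop, ?_⟩
  ext x
  simp

theorem isCozeroSet_empty : IsCozeroSet (∅ : Set X) :=
  isCozeroSet_iff.2 ⟨fun _ => 0, continuous_const, by simp⟩

theorem BaireOne.isCozDelta_preimage {g : X → ℝ} (hg : BaireOne g) {C : Set ℝ}
    (hC : IsClosed C) : IsCozDelta (g ⁻¹' C) := by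
  rcases C.eq_empty_or_nonempty with rfl | hne
  · exact ⟨fun _ => ∅, fun _ => isCozeroSet_empty, by rw [preimage_empty, iInter_const]⟩
  obtain ⟨G, hG, hlim⟩ := hg
  have hd : Continuous fun y => Metric.infDist y C := Metric.continuous_infDist_pt C
  have key : g ⁻¹' C = ⋂ m : ℕ, ⋂ N : ℕ, ⋃ k : ℕ,
      {x | Metric.infDist (G (N + k) x) C < 1 / ((m : ℝ) + 1)} := by
    ext x
    have hx : Tendsto (fun n => Metric.infDist (G n x) C) atTop (𝓝 (Metric.infDist (g x) C)) :=
      (hd.tendsto _).comp (hlim x)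
    simp only [mem_preimage, mem_iInter, mem_iUnion, mem_ofPred_eq,
      hC.mem_iff_infDist_zero hne]
    constructor
    · intro h m N
      rw [h] at hx
      obtain ⟨k, hk, hNk⟩ :=
        ((hx.eventually_lt_const (Nat.one_div_pos_of_nat (n := m))).and
          (eventually_ge_atTop N)).exists
      exact ⟨k - N, by rwa [Nat.add_sub_cancel' hNk]⟩
    · intro h
      refine le_antisymm (le_of_forall_pos_le_add fun ε hε => ?_) Metric.infDist_nonneg
      obtain ⟨m, hm⟩ := exists_nat_one_div_lt hε
      rw [zero_add]
      by_contra! hlt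
      obtain ⟨N, hN⟩ := eventually_atTop.1 (hx.eventually_const_lt hlt)
      obtain ⟨k, hk⟩ := h m N
      linarith [hN (N + k) (Nat.le_add_right _ _)]
  rw [key]
  exact IsCozDelta.iInter_iInter fun m N => IsCozeroSet.iUnion fun k =>
    isCozeroSet_lt (hd.comp (hG _)) _

end Cozero

section BaireOne

variable {X : Type*} [TopologicalSpace X]

theorem Continuous.baireOne {f : X → ℝ} (hf : Continuous f) : BaireOne f :=
  ⟨fun _ => f, fun _ => hf, fun _ => tendsto_const_nhds⟩

theorem BaireOne.add {f g : X → ℝ} (hf : BaireOne f) (hg : BaireOne g) :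
    BaireOne fun x => f x + g x := by
  obtain ⟨F, hF, hFl⟩ := hf
  obtain ⟨G, hG, hGl⟩ := hg
  exact ⟨fun n x => F n x + G n x, fun n => (hF n).add (hG n), fun x => (hFl x).add (hGl x)⟩

theorem BaireOne.const_mul {f : X → ℝ} (hf : BaireOne f) (c : ℝ) :
    BaireOne fun x => c * f x := by
  obtain ⟨F, hF, hFl⟩ := hf
  exact ⟨fun n x => c * F n x, fun n => (hF n).const_mul c, fun x => (hFl x).const_mul c⟩

theorem BaireOne.sub {f g : X → ℝ} (hf : BaireOne f) (hg : BaireOne g) :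
    BaireOne fun x => f x - g x := by
  simpa [sub_eq_add_neg] using hf.add (hg.const_mul (-1))

/-- A function that is constant on the successive differences of a countable cover by zero-sets
is Baire-one. -/
theorem baireOne_of_zeroSet_cover {Z : ℕ → Set X} (hZ : ∀ j, IsZeroSet (Z j)) (d : ℕ → ℝ)
    {g : X → ℝ} (hg : ∀ x, ∃ j, x ∈ Z j ∧ (∀ i < j, x ∉ Z i) ∧ g x = d j) : BaireOne g := by
  choose φ hφ hZφ using hZ
  refine ⟨fun k x => ∑ j ∈ Finset.range (k + 1),
    d j * (max 0 (1 - k * |φ j x|) * ∏ i ∈ Finset.range j, min 1 (k * |φ i x|)),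
    fun k => by fun_prop, fun x => ?_⟩
  obtain ⟨j, hj, hlt, hgj⟩ := hg x
  rw [hgj]
  have hj0 : φ j x = 0 := by simpa [hZφ] using hj
  have hbig : ∀ᶠ k : ℕ in atTop, ∀ i ∈ Finset.range j, 1 ≤ k * |φ i x| := by
    refine (Finset.eventually_all _).2 fun i hi => ?_
    have hne : φ i x ≠ 0 := by simpa [hZφ] using hlt i (Finset.mem_range.1 hi)
    exact (tendsto_natCast_atTop_atTop.atTop_mul_const (abs_pos.2 hne)).eventually_ge_atTop 1
  refine tendsto_const_nhds.congr' ?_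
  filter_upwards [hbig, eventually_ge_atTop j] with k hk hjk
  rw [Finset.sum_eq_single_of_mem j (Finset.mem_range.2 (Nat.lt_succ_of_le hjk))]
  · rw [Finset.prod_eq_one fun i hi => min_eq_left (hk i hi)]
    simp [hj0]
  · intro i _ hij
    rcases lt_or_gt_of_ne hij with h | h
    · rw [max_eq_left (by linarith [hk i (Finset.mem_range.2 h)])]
      simp
    · rw [Finset.prod_eq_zero (Finset.mem_range.2 h) (by simp [hj0])]
      simp

theorem IsCozDelta.exists_zeroSet_cover_compl {s : Set X} (hs : IsCozDelta s) :
    ∃ Z : ℕ → Set X, (∀ n, IsZeroSet (Z n)) ∧ ⋃ n, Z n = sᶜ := by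
  obtain ⟨F, hF, rfl⟩ := hs
  exact ⟨fun n => (F n)ᶜ, hF, by simp⟩

/-- Every real function on a countable strongly Coz_δ-disjoint set extends to a Baire-one
function. -/
theorem StronglyCozDeltaDisjoint.exists_baireOne_eqOn {A : Set X} (hA : A.Countable)
    (hsd : StronglyCozDeltaDisjoint A) (h : X → ℝ) : ∃ g, BaireOne g ∧ EqOn g h A := by
  obtain ⟨F, hmem, hdisj, -, hunion⟩ := hsd
  have := hA.to_subtype
  obtain ⟨e, he⟩ := exists_surjective_nat (Option A × ℕ)
  let V : Option A → Set A := fun o => {a | o ≠ some a}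
  choose Z hZ hZV using fun o => (hunion (V o)).exists_zeroSet_cover_compl
  have hcover : ∀ x, ∃ j, x ∈ Z (e j).1 (e j).2 := by
    intro x
    have : ∃ o, x ∈ (⋃ a ∈ V o, F a)ᶜ := by
      by_cases hx : ∃ a, x ∈ F a
      · obtain ⟨a, ha⟩ := hx
        refine ⟨some a, fun hx' => ?_⟩
        simp only [mem_iUnion] at hx'
        obtain ⟨b, hb, hxb⟩ := hx'
        exact disjoint_left.1 (hdisj fun hab : a = b => hb (congrArg some hab)) ha hxb
      · refine ⟨none, fun hx' => ?_⟩
        simp only [mem_iUnion] at hx'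
        obtain ⟨b, -, hxb⟩ := hx'
        exact hx ⟨b, hxb⟩
    obtain ⟨o, ho⟩ := this
    rw [← hZV o, mem_iUnion] at ho
    obtain ⟨n, hn⟩ := ho
    obtain ⟨j, hj⟩ := he (o, n)
    exact ⟨j, by rwa [hj]⟩
  classical
  let d : ℕ → ℝ := fun j => (e j).1.elim 0 fun a => h a
  refine ⟨fun x => d (Nat.find (hcover x)),
    baireOne_of_zeroSet_cover (Z := fun j => Z (e j).1 (e j).2) (fun j => hZ _ _) d fun x =>
      ⟨Nat.find (hcover x), Nat.find_spec (hcover x), fun i hi => Nat.find_min (hcover x) hi,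
        rfl⟩, fun a ha => ?_⟩
  have hspec := Nat.find_spec (hcover a)
  have ho : a ∈ (⋃ b ∈ V (e (Nat.find (hcover a))).1, F b)ᶜ :=
    hZV _ ▸ mem_iUnion.2 ⟨_, hspec⟩
  have hsome : (e (Nat.find (hcover a))).1 = some ⟨a, ha⟩ := by
    by_contra hne
    exact ho (mem_biUnion (show (⟨a, ha⟩ : A) ∈ V _ from hne) (hmem ⟨a, ha⟩))
  simp only [d, hsome, Option.elim]

/-- A countable set on which all real functions extend to Baire-one functions is strongly
Coz_δ-disjoint. -/
theorem stronglyCozDeltaDisjoint_of_exists_baireOne_eqOn {A : Set X} (hA : A.Countable)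
    (hext : ∀ h : X → ℝ, ∃ g, BaireOne g ∧ EqOn g h A) : StronglyCozDeltaDisjoint A := by
  obtain ⟨e, he⟩ := countable_iff_exists_injOn.1 hA
  obtain ⟨g, hg, hge⟩ := hext fun x => (e x : ℝ)
  have hclosed : ∀ T : Set ℕ, IsClosed ((fun n : ℕ => (n : ℝ)) '' T) := fun T =>
    Nat.isClosedEmbedding_coe_real.isClosedMap T (isClosed_discrete T)
  refine ⟨fun a => g ⁻¹' {(e a : ℝ)}, fun a => hge a.2, fun a b hab => ?_,
    fun a => hg.isCozDelta_preimage isClosed_singleton, fun S => ?_⟩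
  · refine Disjoint.preimage g (disjoint_singleton.2 fun h => hab ?_)
    exact Subtype.ext (he a.2 b.2 (Nat.cast_injective h))
  · convert hg.isCozDelta_preimage (hclosed ((fun a : A => e a) '' S)) using 1
    ext x
    simp [eq_comm]

end BaireOne

section PointwiseTopology

variable {X : Type*} [TopologicalSpace X]

/-- The basic open set of Baire-one functions that are `δ`-close to `f` on `K`. -/
def baireOneBox (f : X → ℝ) (K : Finset X) (δ : ℝ) : Set {f : X → ℝ // BaireOne f} :=
  {g | ∀ x ∈ K, |g.1 x - f x| < δ}

theorem continuous_baireOne_eval (x : X) :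
    Continuous fun g : {f : X → ℝ // BaireOne f} => g.1 x :=
  (continuous_apply x).comp continuous_subtype_val

theorem isOpen_baireOneBox (f : X → ℝ) (K : Finset X) (δ : ℝ) :
    IsOpen (baireOneBox f K δ) := by
  have : baireOneBox f K δ = ⋂ x ∈ K, {g | |g.1 x - f x| < δ} := by
    ext g
    simp [baireOneBox]
  rw [this]
  exact isOpen_biInter_finset fun x _ =>
    isOpen_lt ((continuous_baireOne_eval x).sub continuous_const).abs continuous_const

theorem self_mem_baireOneBox (f : {f : X → ℝ // BaireOne f}) (K : Finset X) {δ : ℝ}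
    (hδ : 0 < δ) : f ∈ baireOneBox f.1 K δ :=
  fun x _ => by simpa using hδ

theorem exists_baireOneBox_subset {V : Set {f : X → ℝ // BaireOne f}} (hV : IsOpen V)
    {f : {f : X → ℝ // BaireOne f}} (hf : f ∈ V) :
    ∃ (K : Finset X) (δ : ℝ), 0 < δ ∧ baireOneBox f.1 K δ ⊆ V := by
  obtain ⟨W, hW, rfl⟩ := isOpen_induced_iff.1 hV
  obtain ⟨K, u, hu, hsub⟩ := isOpen_pi_iff.1 hW f.1 hf
  have hev : ∀ᶠ δ : ℝ in 𝓝[>] 0, ∀ x ∈ K, Metric.ball (f.1 x) δ ⊆ u x := by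
    refine (Finset.eventually_all _).2 fun x hx => ?_
    obtain ⟨ε, hε, hball⟩ := Metric.isOpen_iff.1 (hu x hx).1 _ (hu x hx).2
    filter_upwards [Ioo_mem_nhdsGT hε] with δ hδ
    exact (Metric.ball_subset_ball hδ.2.le).trans hball
  obtain ⟨δ, hδ, hpos⟩ := (hev.and self_mem_nhdsWithin).exists
  exact ⟨K, δ, hpos, fun g hg => hsub fun x hx => hδ x hx (hg x hx)⟩

theorem mem_closure_baireOneBox {f : X → ℝ} {K : Finset X} {δ : ℝ}
    {u g : {f : X → ℝ // BaireOne f}} (hu : u ∈ baireOneBox f K δ)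
    (hg : ∀ x ∈ K, |g.1 x - f x| ≤ δ) : g ∈ closure (baireOneBox f K δ) := by
  let t : ℕ → ℝ := fun k => 1 / ((k : ℝ) + 1)
  have ht : Tendsto t atTop (𝓝 0) := tendsto_one_div_add_atTop_nhds_zero_nat
  let w : ℕ → {f : X → ℝ // BaireOne f} := fun k =>
    ⟨fun x => g.1 x + t k * (u.1 x - g.1 x), g.2.add ((u.2.sub g.2).const_mul _)⟩
  refine mem_closure_of_tendsto (f := w) (b := atTop) ?_ (Eventually.of_forall fun k x hx => ?_)
  · refine tendsto_subtype_rng.2 (tendsto_pi_nhds.2 fun x => ?_)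
    simpa using (ht.mul_const (u.1 x - g.1 x)).const_add (g.1 x)
  · have ht0 : 0 < t k := by positivity
    have ht1 : t k ≤ 1 := by
      rw [div_le_one (by positivity)]
      linarith [(Nat.cast_nonneg k : (0 : ℝ) ≤ k)]
    have h1 := abs_lt.1 (hu x hx)
    have h2 := abs_le.1 (hg x hx)
    simp only [w]
    rw [abs_lt]
    constructor <;> nlinarith

/-- If all functions on countable sets extend to Baire-one functions, then the space of Baire-one
functions is pseudocomplete. -/
theorem pseudocomplete_of_exists_baireOne_eqOn
    (hext : ∀ A : Set X, A.Countable → ∀ h : X → ℝ, ∃ g, BaireOne g ∧ EqOn g h A) :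
    Pseudocomplete {f : X → ℝ // BaireOne f} := by
  refine ⟨fun _ => {U | U.Nonempty ∧ ∃ f K δ, U = baireOneBox f K δ}, fun _ => ⟨?_, ?_⟩, ?_⟩
  · rintro U ⟨hne, f, K, δ, rfl⟩
    exact ⟨isOpen_baireOneBox f K δ, hne⟩
  · rintro V hV ⟨f, hf⟩
    obtain ⟨K, δ, hδ, hsub⟩ := exists_baireOneBox_subset hV hf
    exact ⟨_, ⟨⟨f, self_mem_baireOneBox f K hδ⟩, f.1, K, δ, rfl⟩, hsub⟩
  · intro U hU hcl
    choose hne c K δ hUbox using hU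
    choose u hu using hne
    have hanti : Antitone U := antitone_nat_of_succ_le fun n => subset_closure.trans (hcl n)
    have hclose : ∀ m n, m ≤ n → ∀ x ∈ K m, (u n).1 x ∈ Icc (c m x - δ m) (c m x + δ m) := by
      intro m n hmn x hx
      have hmem := hanti hmn (hu n)
      rw [hUbox m] at hmem
      have := abs_lt.1 (hmem x hx)
      constructor <;> linarith
    have hlim : ∀ x, ∃ y : ℝ, ∀ m, x ∈ K m → |y - c m x| ≤ δ m := by
      intro x
      by_cases hx : ∃ m, x ∈ K m
      · obtain ⟨m₀, hm₀⟩ := hx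
        have hle : ∀ m, x ∈ K m → ∀ᶠ n in (hyperfilter ℕ : Filter ℕ),
            (u n).1 x ∈ Icc (c m x - δ m) (c m x + δ m) := fun m hm =>
          (Nat.hyperfilter_le_atTop) ((eventually_ge_atTop m).mono fun n hn => hclose m n hn x hm)
        obtain ⟨y, -, hy⟩ := isCompact_Icc.ultrafilter_le_nhds
          ((hyperfilter ℕ).map fun n => (u n).1 x) (le_principal_iff.2 (hle m₀ hm₀))
        refine ⟨y, fun m hm => ?_⟩
        have : y ∈ Icc (c m x - δ m) (c m x + δ m) :=
          isClosed_Icc.mem_of_tendsto (b := (hyperfilter ℕ : Filter ℕ)) hy (hle m hm)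
        rw [abs_le]
        constructor <;> linarith [this.1, this.2]
      · exact ⟨0, fun m hm => (hx ⟨m, hm⟩).elim⟩
    choose h hh using hlim
    obtain ⟨g, hg, hgh⟩ := hext (⋃ m, (K m : Set X))
      (countable_iUnion fun m => (K m).countable_toSet) h
    refine ⟨⟨g, hg⟩, mem_iInter.2 fun m => hcl m ?_⟩
    have hum := hu (m + 1)
    rw [hUbox (m + 1)] at hum ⊢
    refine mem_closure_baireOneBox hum fun x hx => ?_
    change |g x - _| ≤ _
    rw [hgh (mem_iUnion.2 ⟨m + 1, hx⟩)]
    exact hh x _ hx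

theorem IsPiBase.exists_closure_subset {Z : Type*} [TopologicalSpace Z] [RegularSpace Z]
    {B : Set (Set Z)} (hB : IsPiBase B) {W : Set Z} (hW : IsOpen W) (hne : W.Nonempty) :
    ∃ U ∈ B, closure U ⊆ W := by
  obtain ⟨z, hz⟩ := hne
  obtain ⟨C, hC, hCcl, hCW⟩ := exists_mem_nhds_isClosed_subset (hW.mem_nhds hz)
  obtain ⟨U, hU, hUC⟩ := hB.2 (interior C) isOpen_interior ⟨z, mem_interior_iff_mem_nhds.2 hC⟩
  exact ⟨U, hU, (closure_minimal (hUC.trans interior_subset) hCcl).trans hCW⟩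

/-- `IsLinked A h E U V` says that `V` contains a basic box around some `v`, with support
containing `E`, and that `U` contains some `u` with `u - v = h` on the part of the support
lying in `A`. -/
def IsLinked (A : Set X) (h : X → ℝ) (E : Finset X)
    (U V : Set {f : X → ℝ // BaireOne f}) : Prop :=
  ∃ u ∈ U, ∃ (v : {f : X → ℝ // BaireOne f}) (L : Finset X) (δ : ℝ), 0 < δ ∧ E ⊆ L ∧
    baireOneBox v.1 L δ ⊆ V ∧ ∀ x ∈ L, x ∈ A → u.1 x - v.1 x = h x

theorem exists_continuous_eqOn_finset [T35Space X] (K : Finset X) (f : X → ℝ) :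
    ∃ g : X → ℝ, Continuous g ∧ ∀ x ∈ K, g x = f x := by
  classical
  have hsep : ∀ x, ∃ φ : X → ℝ, Continuous φ ∧ φ x = 1 ∧ ∀ y ∈ K, y ≠ x → φ y = 0 := by
    intro x
    obtain ⟨φ, hφ, h0, h1⟩ := CompletelyRegularSpace.completely_regular x
      (K.erase x : Set X) (K.erase x).finite_toSet.isClosed (by simp)
    refine ⟨fun y => 1 - φ y, by fun_prop, by simp [h0], fun y hy hyx => ?_⟩
    simp [h1 (Finset.mem_coe.2 (Finset.mem_erase.2 ⟨hyx, hy⟩))]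
  choose φ hφ h1 h0 using hsep
  refine ⟨fun y => ∑ x ∈ K, f x * φ x y, by fun_prop, fun y hy => ?_⟩
  change ∑ x ∈ K, f x * φ x y = f y
  rw [Finset.sum_eq_single_of_mem y hy fun x _ hxy => by rw [h0 x y hy hxy.symm, mul_zero],
    h1, mul_one]

theorem IsLinked.exists_refinement [T35Space X] {A : Set X} {h : X → ℝ} {E₀ : Finset X}
    {U V : Set {f : X → ℝ // BaireOne f}} (hUV : IsLinked A h E₀ U V) (hU : IsOpen U)
    {B : Set (Set {f : X → ℝ // BaireOne f})} (hB : IsPiBase B) (E : Finset X) {ε : ℝ}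
    (hε : 0 < ε) :
    ∃ U' ∈ B, closure U' ⊆ U ∧ (∀ w ∈ U', ∀ w' ∈ U', ∀ x ∈ E, |w.1 x - w'.1 x| < ε) ∧
      IsLinked A (-h) E V U' := by
  classical
  obtain ⟨u, hu, v, L, δ, hδ, -, hsub, huv⟩ := hUV
  obtain ⟨U', hU'B, hU'⟩ := hB.exists_closure_subset
    (hU.inter (isOpen_baireOneBox u.1 (L ∪ E) (min δ (ε / 2))))
    ⟨u, hu, self_mem_baireOneBox u _ (lt_min hδ (half_pos hε))⟩
  obtain ⟨hopen, u', hu'⟩ := hB.1 U' hU'B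
  obtain ⟨K, η, hη, hK⟩ := exists_baireOneBox_subset hopen hu'
  have hnear : ∀ w ∈ U', ∀ x ∈ L ∪ E, |w.1 x - u.1 x| < min δ (ε / 2) := fun w hw =>
    (hU' (subset_closure hw)).2
  obtain ⟨v', hv', hv'eq⟩ := exists_continuous_eqOn_finset (K ∪ E ∪ L)
    fun x => if x ∈ A then u'.1 x - h x else v.1 x
  refine ⟨U', hU'B, hU'.trans inter_subset_left, fun w hw w' hw' x hx => ?_,
    ⟨v', hv'.baireOne⟩, hsub fun x hx => ?_, u', K ∪ E, η, hη, Finset.subset_union_right,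
    fun g hg => hK fun x hx => hg x (Finset.mem_union_left _ hx), fun x hx hxA => ?_⟩
  · have h1 := abs_lt.1 ((hnear w hw x (Finset.mem_union_right _ hx)).trans_le (min_le_right _ _))
    have h2 := abs_lt.1 ((hnear w' hw' x (Finset.mem_union_right _ hx)).trans_le (min_le_right _ _))
    rw [abs_lt]
    constructor <;> linarith [h1.1, h1.2, h2.1, h2.2]
  · change |v' x - v.1 x| < δ
    rw [hv'eq x (Finset.mem_union_right _ hx)]
    split_ifs with hxA
    · rw [← huv x hx hxA, show u'.1 x - (u.1 x - v.1 x) - v.1 x = u'.1 x - u.1 x by ring]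
      exact (hnear u' hu' x (Finset.mem_union_left _ hx)).trans_le (min_le_left _ _)
    · simpa using hδ
  · change v' x - u'.1 x = -h x
    rw [hv'eq x (Finset.mem_union_left _ hx), if_pos hxA]
    ring

theorem IsLinked.exists_refinement_pair [T35Space X] {A : Set X} {h : X → ℝ} {E₀ : Finset X}
    {U V : Set {f : X → ℝ // BaireOne f}} (hUV : IsLinked A h E₀ U V) (hU : IsOpen U)
    (hV : IsOpen V) {B : Set (Set {f : X → ℝ // BaireOne f})} (hB : IsPiBase B)
    (E : Finset X) {ε : ℝ} (hε : 0 < ε) :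
    ∃ U' ∈ B, ∃ V' ∈ B, closure U' ⊆ U ∧ closure V' ⊆ V ∧ IsLinked A h E U' V' ∧
      ∀ w ∈ U', ∀ z ∈ V', ∀ x ∈ E, x ∈ A → |w.1 x - z.1 x - h x| < ε := by
  obtain ⟨U', hU'B, hU'U, hUsmall, hVU'⟩ := hUV.exists_refinement hU hB E (half_pos hε)
  obtain ⟨V', hV'B, hV'V, hVsmall, hlink⟩ := hVU'.exists_refinement hV hB E (half_pos hε)
  rw [neg_neg] at hlink
  refine ⟨U', hU'B, V', hV'B, hU'U, hV'V, hlink, fun w hw z hz x hx hxA => ?_⟩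
  obtain ⟨u, hu, v, L, δ, hδ, hEL, hsub, huv⟩ := hlink
  have h1 := abs_lt.1 (hUsmall w hw u hu x hx)
  have h2 := abs_lt.1 (hVsmall z hz v (hsub (self_mem_baireOneBox v L hδ)) x hx)
  have h3 := huv x (hEL hx) hxA
  rw [abs_lt]
  constructor <;> linarith [h1.1, h1.2, h2.1, h2.2]

/-- If the space of Baire-one functions is pseudocomplete, then every function on a countable set
extends to a Baire-one function. -/
theorem Pseudocomplete.exists_baireOne_eqOn [T35Space X]
    (hX : Pseudocomplete {f : X → ℝ // BaireOne f}) {A : Set X} (hA : A.Countable)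
    (h : X → ℝ) : ∃ g, BaireOne g ∧ EqOn g h A := by
  classical
  obtain ⟨B, hB, hcomplete⟩ := hX
  rcases A.eq_empty_or_nonempty with rfl | hne
  · exact ⟨fun _ => 0, continuous_const.baireOne, eqOn_empty _ _⟩
  obtain ⟨a, rfl⟩ := hA.exists_eq_range hne
  let E : ℕ → Finset X := fun n => (Finset.range (n + 1)).image a
  let ε : ℕ → ℝ := fun n => 1 / ((n : ℝ) + 1)
  have hε : ∀ n, 0 < ε n := fun n => by positivity
  let S := Set {f : X → ℝ // BaireOne f}
  let P : ℕ → S × S → Prop := fun n p => p.1 ∈ B n ∧ p.2 ∈ B n ∧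
    IsLinked (range a) h (E n) p.1 p.2 ∧
    ∀ w ∈ p.1, ∀ z ∈ p.2, ∀ x ∈ E n, x ∈ range a → |w.1 x - z.1 x - h x| < ε n
  have hstart : ∃ p, P 0 p := by
    have hlink : IsLinked (range a) h ∅ univ univ :=
      ⟨⟨fun _ => 0, continuous_const.baireOne⟩, mem_univ _,
        ⟨fun _ => 0, continuous_const.baireOne⟩, ∅, 1, one_pos, Finset.Subset.refl _,
        subset_univ _, by simp⟩
    obtain ⟨U, hU, V, hV, -, -, hUV, hsmall⟩ :=
      hlink.exists_refinement_pair isOpen_univ isOpen_univ (hB 0) (E 0) (hε 0)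
    exact ⟨(U, V), hU, hV, hUV, hsmall⟩
  have hstep : ∀ n p, P n p →
      ∃ q, P (n + 1) q ∧ closure q.1 ⊆ p.1 ∧ closure q.2 ⊆ p.2 := by
    rintro n ⟨U, V⟩ ⟨hU, hV, hUV, -⟩
    obtain ⟨U', hU', V', hV', hUU', hVV', hUV', hsmall⟩ :=
      hUV.exists_refinement_pair ((hB n).1 U hU).1 ((hB n).1 V hV).1 (hB (n + 1)) (E (n + 1))
        (hε (n + 1))
    exact ⟨(U', V'), ⟨hU', hV', hUV', hsmall⟩, hUU', hVV'⟩
  choose p₀ hp₀ using hstart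
  choose! next hnext using hstep
  let p : ℕ → S × S := fun n => Nat.rec p₀ next n
  have hp : ∀ n, P n (p n) := by
    intro n
    induction n with
    | zero => exact hp₀
    | succ n ih => exact (hnext n _ ih).1
  obtain ⟨u, hu⟩ := hcomplete (fun n => (p n).1) (fun n => (hp n).1)
    fun n => (hnext n _ (hp n)).2.1
  obtain ⟨v, hv⟩ := hcomplete (fun n => (p n).2) (fun n => (hp n).2.1)
    fun n => (hnext n _ (hp n)).2.2
  refine ⟨fun x => u.1 x - v.1 x, u.2.sub v.2, ?_⟩
  rintro _ ⟨i, rfl⟩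
  have hbound : ∀ n ≥ i, |u.1 (a i) - v.1 (a i) - h (a i)| ≤ ε n := fun n hn =>
    ((hp n).2.2.2 u (mem_iInter.1 hu n) v (mem_iInter.1 hv n) (a i)
      (Finset.mem_image_of_mem a (Finset.mem_range.2 (Nat.lt_succ_of_le hn)))
      (mem_range_self i)).le
  have hzero : |u.1 (a i) - v.1 (a i) - h (a i)| ≤ 0 :=
    ge_of_tendsto tendsto_one_div_add_atTop_nhds_zero_nat (eventually_atTop.2 ⟨i, hbound⟩)
  exact sub_eq_zero.1 (abs_nonpos_iff.1 hzero)

end PointwiseTopology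

/-- For a Tychonoff space `X`, the space `B₁(X)` is pseudocomplete iff
every countable subset of `X` is strongly Coz_δ-disjoint. -/
theorem statement18 {X : Type*} [TopologicalSpace X] [T35Space X] :
    Pseudocomplete {f : X → ℝ // BaireOne f} ↔
      ∀ A : Set X, A.Countable → StronglyCozDeltaDisjoint A := by
  constructor
  · exact fun hX A hA => stronglyCozDeltaDisjoint_of_exists_baireOne_eqOn hA fun h =>
      hX.exists_baireOne_eqOn hA h
  · exact fun hsd => pseudocomplete_of_exists_baireOne_eqOn fun A hA h =>
      (hsd A hA).exists_baireOne_eqOn hA h
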